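/- Let R be a commutative ring with elements h_1, h_2, h_3, … ∈ R, extended by setting h_0 = 1 and h_m = 0 for all integers m < 0. Let a = (a_1, …, a_s) be a composition of a positive integer n, and define the partitions λ and μ by λ_i = (a_1 + ⋯ + a_{s+1−i}) + i − s for 1 ≤ i ≤ s, μ_j = (a_1 + ⋯ + a_{s−j}) + j − s for 1 ≤ j ≤ s − 1, and μ_s = 0. Then Ψ(a) equals the Jacobi–Trudi determinant of the associated ribbon skew shape: Ψ(a) = det_{1 ≤ i, j ≤ s}( h_{λ_i − μ_j − i + j} ). -/

import Mathlib

/-- A composition of `n`: a list of positive integers summing to `n`. -/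
def IsComposition (n : ℕ) (a : List ℕ) : Prop :=
  (∀ x ∈ a, 0 < x) ∧ a.sum = n

/-- `b` is a coarsening of `a`: `b` is obtained by summing consecutive nonempty blocks of `a`. -/
def Coarsen (a b : List ℕ) : Prop :=
  ∃ L : List (List ℕ), (∀ l ∈ L, l ≠ []) ∧ L.flatten = a ∧ b = L.map List.sum

/-- `Ψ(a) = Σ_{a ⪯ b} (−1)^{l(b)−l(a)} h_{b_1} ⋯ h_{b_{l(b)}}`, summed over all
coarsenings `b` of `a` (a finite set).  Since `l(b) ≤ l(a)`, the sign
`(−1)^{l(b)−l(a)}` equals `(−1)^{l(a)−l(b)}`. -/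
noncomputable def Psi {R : Type*} [CommRing R] (h : ℕ → R) (a : List ℕ) : R :=
  ∑ᶠ b ∈ {b : List ℕ | Coarsen a b},
    (-1 : R) ^ (a.length - b.length) * (b.map h).prod

lemma coarsen_cons_cons_iff (x y : ℕ) (t b : List ℕ) :
    Coarsen (x :: y :: t) b ↔
      (∃ c, Coarsen (y :: t) c ∧ x :: c = b) ∨ Coarsen ((x + y) :: t) b := by
  constructor
  · rintro ⟨L, hL, hf, rfl⟩
    match L, hL, hf with
    | [] :: L', hL, _ => simp at hL
    | [z] :: L', hL, hf' =>
      simp only [List.flatten_cons, List.cons_append, List.nil_append, List.cons.injEq] at hf'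
      obtain ⟨rfl, hf'⟩ := hf'
      exact Or.inl ⟨L'.map List.sum, ⟨L', fun l hl => hL l (by simp [hl]), hf', rfl⟩, by simp⟩
    | (z :: w :: l) :: L', hL, hf' =>
      simp only [List.flatten_cons, List.cons_append, List.cons.injEq] at hf'
      obtain ⟨rfl, rfl, hf'⟩ := hf'
      refine Or.inr ⟨((z + w) :: l) :: L', ?_, by simp [hf'], by simp [add_assoc]⟩
      intro m hm
      rcases List.mem_cons.1 hm with rfl | hm
      · simp
      · exact hL m (by simp [hm])
  · rintro (⟨c, ⟨L, hL, hf, rfl⟩, rfl⟩ | ⟨L, hL, hf, rfl⟩)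
    · refine ⟨[x] :: L, ?_, by simp [hf], by simp⟩
      intro m hm
      rcases List.mem_cons.1 hm with rfl | hm
      · simp
      · exact hL m hm
    · match L, hL, hf with
      | [] :: L', hL, _ => simp at hL
      | (z :: l) :: L', hL, hf =>
        simp only [List.flatten_cons, List.cons_append, List.cons.injEq] at hf
        obtain ⟨rfl, hf⟩ := hf
        refine ⟨(x :: y :: l) :: L', ?_, by simp [hf], by simp [add_assoc]⟩
        intro m hm
        rcases List.mem_cons.1 hm with rfl | hm
        · simp
        · exact hL m (by simp [hm])

lemma coarsen_singleton_iff (x : ℕ) (b : List ℕ) : Coarsen [x] b ↔ b = [x] := by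
  constructor
  · rintro ⟨L, hL, hf, rfl⟩
    match L, hL, hf with
    | [] :: L', hL, _ => simp at hL
    | (z :: l) :: [], hL, hf => simp_all
    | (z :: l) :: [] :: L', hL, hf => simp at hL
    | (z :: l) :: (w :: m) :: L', hL, hf => simp at hf
  · rintro rfl
    exact ⟨[[x]], by simp, by simp, by simp⟩

lemma setOf_coarsen_cons_cons (x y : ℕ) (t : List ℕ) :
    {b | Coarsen (x :: y :: t) b} =
      (x :: ·) '' {c | Coarsen (y :: t) c} ∪ {b | Coarsen ((x + y) :: t) b} := by
  ext b
  exact coarsen_cons_cons_iff x y t b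

lemma finite_setOf_coarsen_cons (x : ℕ) (t : List ℕ) : {b | Coarsen (x :: t) b}.Finite := by
  induction t generalizing x with
  | nil => simp [coarsen_singleton_iff]
  | cons y t ih =>
    rw [setOf_coarsen_cons_cons]
    exact ((ih y).image _).union (ih (x + y))

lemma Coarsen.length_le {a b : List ℕ} (hab : Coarsen a b) : b.length ≤ a.length := by
  obtain ⟨L, hL, rfl, rfl⟩ := hab
  induction L with
  | nil => simp
  | cons l L ih =>
    have hl : 0 < l.length := List.length_pos_iff.2 (hL l (by simp))
    have := ih fun m hm => hL m (by simp [hm])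
    simp only [List.length_map, List.length_cons, List.flatten_cons, List.length_append] at this ⊢
    omega

lemma Coarsen.le_head {x z : ℕ} {t b : List ℕ} (h : Coarsen (x :: t) (z :: b)) : x ≤ z := by
  obtain ⟨L, hL, hf, hb⟩ := h
  match L, hL, hf, hb with
  | [] :: L', hL, _, _ => simp at hL
  | (w :: l) :: L', hL, hf, hb =>
    simp only [List.flatten_cons, List.cons_append, List.cons.injEq] at hf
    simp only [List.map_cons, List.sum_cons, List.cons.injEq] at hb
    omega

lemma Psi_singleton {R : Type*} [CommRing R] (h : ℕ → R) (x : ℕ) : Psi h [x] = h x := by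
  simp [Psi, coarsen_singleton_iff]

/-- Splitting the coarsenings according to whether the first part stays a block of its own. -/
lemma Psi_cons_cons {R : Type*} [CommRing R] (h : ℕ → R) (x y : ℕ) (hy : 0 < y) (t : List ℕ) :
    Psi h (x :: y :: t) = h x * Psi h (y :: t) - Psi h ((x + y) :: t) := by
  have hdisj : Disjoint ((x :: ·) '' {c | Coarsen (y :: t) c})
      {b | Coarsen ((x + y) :: t) b} := by
    rw [Set.disjoint_left]
    rintro _ ⟨c, -, rfl⟩ hc
    have := Coarsen.le_head hc
    omega
  have hfin := finite_setOf_coarsen_cons y t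
  unfold Psi
  rw [setOf_coarsen_cons_cons, finsum_mem_union hdisj (hfin.image _)
    (finite_setOf_coarsen_cons _ _), finsum_mem_image List.cons_injective.injOn,
    mul_finsum_mem' _ _ hfin, sub_eq_add_neg, ← finsum_mem_neg_distrib _ (finite_setOf_coarsen_cons _ _)]
  congr 1
  · refine finsum_mem_congr rfl fun c _ => ?_
    simp only [List.length_cons, Nat.add_sub_add_right, List.map_cons, List.prod_cons]
    ring
  · refine finsum_mem_congr rfl fun b hb => ?_
    have hlen := Coarsen.length_le hb
    simp only [List.length_cons] at hlen ⊢
    rw [Nat.sub_add_comm hlen, pow_succ]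
    ring

/-- The leading `n × n` part of the Jacobi–Trudi matrix of the ribbon with rows `a`, with rows
and columns in reverse order. -/
def ribbonMatrix {R : Type*} (H : ℤ → R) (a : List ℕ) (n : ℕ) : Matrix (Fin n) (Fin n) R :=
  Matrix.of fun i j => H (((a.take (i + 1)).sum : ℤ) - ((a.take j).sum : ℤ))

/-- Expansion of the ribbon determinant along its first row. -/
lemma det_ribbonMatrix_cons_cons {R : Type*} [CommRing R] (H : ℤ → R)
    (hH0 : H 0 = 1) (hHneg : ∀ m : ℤ, m < 0 → H m = 0) (x y : ℕ) (hy : 0 < y) (t : List ℕ)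
    (n : ℕ) :
    (ribbonMatrix H (x :: y :: t) (n + 2)).det =
      H x * (ribbonMatrix H (y :: t) (n + 1)).det -
        (ribbonMatrix H ((x + y) :: t) (n + 1)).det := by
  rw [Matrix.det_succ_row_zero, Fin.sum_univ_succ, Fin.sum_univ_succ, Finset.sum_eq_zero, add_zero]
  · rw [sub_eq_add_neg]
    congr 1
    · congr 1
      · simp [ribbonMatrix]
      · congr 1
        ext i j
        simp [ribbonMatrix]
    · have hminor : (ribbonMatrix H (x :: y :: t) (n + 2)).submatrix Fin.succ
          (Fin.succ 0).succAbove = ribbonMatrix H ((x + y) :: t) (n + 1) := by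
        ext i j
        refine Fin.cases ?_ (fun j => ?_) j <;> simp [ribbonMatrix, add_assoc]
      rw [hminor]
      simp [ribbonMatrix, hH0]
  · intro j _
    have : ribbonMatrix H (x :: y :: t) (n + 2) 0 j.succ.succ = 0 := by
      apply hHneg
      simp only [Fin.val_zero, Fin.val_succ, List.take_succ_cons, List.take_zero, List.sum_cons,
        List.sum_nil]
      omega
    rw [this]
    simp

lemma Psi_eq_det_ribbonMatrix {R : Type*} [CommRing R] (H : ℤ → R)
    (hH0 : H 0 = 1) (hHneg : ∀ m : ℤ, m < 0 → H m = 0) (x : ℕ) (t : List ℕ)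
    (ht : ∀ y ∈ t, 0 < y) :
    Psi (fun k => H (k : ℤ)) (x :: t) = (ribbonMatrix H (x :: t) (t.length + 1)).det := by
  induction t generalizing x with
  | nil => simp [Psi_singleton, ribbonMatrix]
  | cons y t ih =>
    have hy : 0 < y := ht y (by simp)
    have ht' : ∀ z ∈ t, 0 < z := fun z hz => ht z (by simp [hz])
    rw [Psi_cons_cons _ x y hy, ih y ht', ih (x + y) ht', List.length_cons,
      det_ribbonMatrix_cons_cons H hH0 hHneg x y hy]

/-- Jacobi–Trudi formula for `Ψ(a)`.  Here `H : ℤ → R` is the extension of the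
`h_k` with `H 0 = 1` and `H m = 0` for `m < 0`.  For the composition
`a = (a_1, …, a_s)` (0-indexed in Lean, so row `i` corresponds to `i+1` in the
paper), `λ_i = (a_1 + ⋯ + a_{s+1−i}) + i − s` and
`μ_j = (a_1 + ⋯ + a_{s−j}) + j − s` (which also gives `μ_s = 0`), and
`Ψ(a) = det ( H (λ_i − μ_j − i + j) )`. -/
theorem Psi_jacobi_trudi {R : Type*} [CommRing R] (H : ℤ → R)
    (hH0 : H 0 = 1) (hHneg : ∀ m : ℤ, m < 0 → H m = 0)
    (n : ℕ) (hn : 0 < n) (a : List ℕ) (ha : IsComposition n a) :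
    Psi (fun k => H (k : ℤ)) a =
      Matrix.det (Matrix.of fun i j : Fin a.length =>
        H (((((a.take (a.length - (i : ℕ))).sum : ℤ) + ((i : ℕ) + 1) - a.length)
          - (((a.take (a.length - 1 - (j : ℕ))).sum : ℤ) + ((j : ℕ) + 1) - a.length))
          - ((i : ℕ) + 1) + ((j : ℕ) + 1))) := by
  obtain ⟨hpos, hsum⟩ := ha
  cases a with
  | nil => simp at hsum; omega
  | cons x t =>
    rw [Psi_eq_det_ribbonMatrix H hH0 hHneg x t fun y hy => hpos y (by simp [hy]),
      ← Matrix.det_submatrix_equiv_self Fin.revPerm]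
    congr 1
    ext i j
    simp only [ribbonMatrix, Matrix.submatrix_apply, Matrix.of_apply, Fin.revPerm_apply,
      Fin.val_rev, List.length_cons]
    have hi : t.length + 1 - (i + 1) + 1 = t.length + 1 - i := by have := i.isLt; omega
    have hj : t.length + 1 - (j + 1) = t.length + 1 - 1 - j := by omega
    rw [hi, hj]
    congr 1
    ring
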